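/- arXiv:2501.06098 — 2 statements merged into one kernel-verified Lean document; each statement's English description precedes it below -/
import Mathlib

section
/- The Frobenius norm of the difference satisfies ‖exp(Q̄)exp(K̄)ᵀ − exp(Q̄K̄ᵀ)‖_F ≤ max(|c₁/(𝓜·exp(−0.5)) − 1|, |c₁/(𝔐·exp(−0.5)) − 1|) · ‖exp(Q̄K̄ᵀ)‖_F. -/
open Matrix Finset

/-- Entrywise exponential of a real matrix. -/
noncomputable def eexp {α β : Type*} (A : Matrix α β ℝ) : Matrix α β ℝ := A.map Real.exp

/-- Frobenius norm of a real matrix. -/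
noncomputable def frob {α β : Type*} [Fintype α] [Fintype β] (A : Matrix α β ℝ) : ℝ :=
  Real.sqrt (∑ i, ∑ j, (A i j) ^ 2)

/-- The all-ones square matrix. -/
def allOnes (α : Type*) : Matrix α α ℝ := Matrix.of fun _ _ => 1

/-- 𝔐: the maximum of exp(⟨q̄ᵢ₁, k̄ᵢ₂⟩ + 0.5 − (q̄ᵢ₁ⱼ + k̄ᵢ₂ⱼ)). -/
noncomputable def bigM {ι : Type*} [Fintype ι] [Nonempty ι] {c₁ : ℕ} [NeZero c₁]
    (Q K : Matrix ι (Fin c₁) ℝ) : ℝ :=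
  Finset.univ.sup' Finset.univ_nonempty fun p : ι × ι × Fin c₁ =>
    Real.exp ((∑ j, Q p.1 j * K p.2.1 j) + 0.5 - (Q p.1 p.2.2 + K p.2.1 p.2.2))

/-- 𝓜: the minimum of exp(⟨q̄ᵢ₁, k̄ᵢ₂⟩ + 0.5 − (q̄ᵢ₁ⱼ + k̄ᵢ₂ⱼ)). -/
noncomputable def smallM {ι : Type*} [Fintype ι] [Nonempty ι] {c₁ : ℕ} [NeZero c₁]
    (Q K : Matrix ι (Fin c₁) ℝ) : ℝ :=
  Finset.univ.inf' Finset.univ_nonempty fun p : ι × ι × Fin c₁ =>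
    Real.exp ((∑ j, Q p.1 j * K p.2.1 j) + 0.5 - (Q p.1 p.2.2 + K p.2.1 p.2.2))

/-- Z = I_b ⊗ U_p : the block-diagonal 0/1 mask with b diagonal all-ones p×p blocks. -/
def blockZ (b p : ℕ) : Matrix (Fin b × Fin p) (Fin b × Fin p) ℝ :=
  Matrix.kroneckerMap (· * ·) (1 : Matrix (Fin b) (Fin b) ℝ) (allOnes (Fin p))

theorem frob_le_mul_frob {α β : Type*} [Fintype α] [Fintype β] {A B : Matrix α β ℝ} {C : ℝ}
    (hC : 0 ≤ C) (h : ∀ i j, |A i j| ≤ C * |B i j|) : frob A ≤ C * frob B := by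
  unfold frob
  rw [← Real.sqrt_sq hC, ← Real.sqrt_mul (sq_nonneg C)]
  refine Real.sqrt_le_sqrt ?_
  simp only [Finset.mul_sum]
  gcongr with i _ j _
  rw [← sq_abs (A i j), ← sq_abs (B i j), ← mul_pow]
  gcongr
  exact h i j

section Extrema

variable {ι : Type*} [Fintype ι] [Nonempty ι] {c₁ : ℕ} [NeZero c₁] (Q K : Matrix ι (Fin c₁) ℝ)

theorem smallM_pos : 0 < smallM Q K := by
  simp [smallM, Finset.lt_inf'_iff, Real.exp_pos]

theorem smallM_le (i₁ i₂ : ι) (j : Fin c₁) :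
    smallM Q K ≤ Real.exp ((Q * Kᵀ) i₁ i₂ + 0.5 - (Q i₁ j + K i₂ j)) :=
  Finset.inf'_le (fun p : ι × ι × Fin c₁ =>
    Real.exp ((∑ j, Q p.1 j * K p.2.1 j) + 0.5 - (Q p.1 p.2.2 + K p.2.1 p.2.2)))
    (Finset.mem_univ (i₁, i₂, j))

theorem le_bigM (i₁ i₂ : ι) (j : Fin c₁) :
    Real.exp ((Q * Kᵀ) i₁ i₂ + 0.5 - (Q i₁ j + K i₂ j)) ≤ bigM Q K :=
  Finset.le_sup' (fun p : ι × ι × Fin c₁ =>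
    Real.exp ((∑ j, Q p.1 j * K p.2.1 j) + 0.5 - (Q p.1 p.2.2 + K p.2.1 p.2.2)))
    (Finset.mem_univ (i₁, i₂, j))

theorem exp_mul_exp_eq_div (s a b : ℝ) :
    Real.exp a * Real.exp b =
      Real.exp s / (Real.exp (s + 0.5 - (a + b)) * Real.exp (-0.5)) := by
  rw [← Real.exp_add, ← Real.exp_add, ← Real.exp_sub]
  congr 1
  ring

theorem eexp_mul_eexp_transpose_le (i₁ i₂ : ι) :
    (eexp Q * (eexp K)ᵀ) i₁ i₂ ≤
      c₁ / (smallM Q K * Real.exp (-0.5)) * eexp (Q * Kᵀ) i₁ i₂ := by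
  have hpos := smallM_pos Q K
  calc (eexp Q * (eexp K)ᵀ) i₁ i₂
      = ∑ j, Real.exp (Q i₁ j) * Real.exp (K i₂ j) := rfl
    _ ≤ ∑ _j : Fin c₁, Real.exp ((Q * Kᵀ) i₁ i₂) / (smallM Q K * Real.exp (-0.5)) := by
        refine Finset.sum_le_sum fun j _ => ?_
        rw [exp_mul_exp_eq_div ((Q * Kᵀ) i₁ i₂)]
        gcongr
        exact smallM_le Q K i₁ i₂ j
    _ = _ := by
        simp only [Finset.sum_const, Finset.card_univ, Fintype.card_fin, nsmul_eq_mul, eexp,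
          Matrix.map_apply]
        ring

theorem le_eexp_mul_eexp_transpose (i₁ i₂ : ι) :
    c₁ / (bigM Q K * Real.exp (-0.5)) * eexp (Q * Kᵀ) i₁ i₂ ≤
      (eexp Q * (eexp K)ᵀ) i₁ i₂ := by
  calc c₁ / (bigM Q K * Real.exp (-0.5)) * eexp (Q * Kᵀ) i₁ i₂
      = ∑ _j : Fin c₁, Real.exp ((Q * Kᵀ) i₁ i₂) / (bigM Q K * Real.exp (-0.5)) := by
        simp only [Finset.sum_const, Finset.card_univ, Fintype.card_fin, nsmul_eq_mul, eexp,
          Matrix.map_apply]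
        ring
    _ ≤ ∑ j, Real.exp (Q i₁ j) * Real.exp (K i₂ j) := by
        refine Finset.sum_le_sum fun j _ => ?_
        rw [exp_mul_exp_eq_div ((Q * Kᵀ) i₁ i₂)]
        gcongr
        exact le_bigM Q K i₁ i₂ j
    _ = (eexp Q * (eexp K)ᵀ) i₁ i₂ := rfl

end Extrema

/-- ‖exp(Q̄)exp(K̄)ᵀ − exp(Q̄K̄ᵀ)‖_F ≤
max(|c₁/(𝓜·exp(−0.5)) − 1|, |c₁/(𝔐·exp(−0.5)) − 1|) · ‖exp(Q̄K̄ᵀ)‖_F. -/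
theorem stmt_6 (m c₁ : ℕ) [NeZero m] [NeZero c₁] (Qb Kb : Matrix (Fin m) (Fin c₁) ℝ) :
    frob (eexp Qb * (eexp Kb)ᵀ - eexp (Qb * Kbᵀ)) ≤
      max |(c₁ : ℝ) / (smallM Qb Kb * Real.exp (-0.5)) - 1|
          |(c₁ : ℝ) / (bigM Qb Kb * Real.exp (-0.5)) - 1| *
        frob (eexp (Qb * Kbᵀ)) := by
  refine frob_le_mul_frob (le_max_of_le_left (abs_nonneg _)) fun i j => ?_
  have hpos : 0 < eexp (Qb * Kbᵀ) i j := Real.exp_pos _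
  have hupper := eexp_mul_eexp_transpose_le Qb Kb i j
  have hlower := le_eexp_mul_eexp_transpose Qb Kb i j
  rw [abs_of_pos hpos, Matrix.sub_apply]
  refine (abs_le_max_abs_abs (a := (c₁ / (bigM Qb Kb * Real.exp (-0.5)) - 1) *
    eexp (Qb * Kbᵀ) i j) (by linarith) (c := (c₁ / (smallM Qb Kb * Real.exp (-0.5)) - 1) *
    eexp (Qb * Kbᵀ) i j) (by linarith)).trans_eq ?_
  rw [abs_mul, abs_mul, abs_of_pos hpos, ← max_mul_of_nonneg _ _ hpos.le, max_comm]
end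

section
/- Suppose |c₁/(𝓜·exp(−0.5)) − 1| ≥ |c₁/(𝔐·exp(−0.5)) − 1|. Then ‖exp(Q̄)exp(K̄)ᵀ − exp(Q̄K̄ᵀ) ⊙ exp(Q̃K̃ᵀ)‖_F ≤ (c₁/(𝓜·exp(−0.5))) · ‖exp(Q̄K̄ᵀ)‖_F · ‖U_m − exp(Q̃K̃ᵀ)‖_F + |c₁/(𝓜·exp(−0.5)) − 1| · ‖exp(Q̄K̄ᵀ)‖_F · ‖exp(Q̃K̃ᵀ)‖_F. -/
open Matrix Finset

theorem frob_add_le {α β : Type*} [Fintype α] [Fintype β] (A B : Matrix α β ℝ) :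
    frob (A + B) ≤ frob A + frob B := by
  let _ : NormedAddCommGroup (Matrix α β ℝ) := Matrix.frobeniusNormedAddCommGroup
  have frob_eq : ∀ C : Matrix α β ℝ, frob C = ‖C‖ := fun C => by
    rw [Matrix.frobenius_norm_def, frob, Real.sqrt_eq_rpow]
    simp
  simpa only [frob_eq] using norm_add_le A B

theorem frob_le_frob_of_abs_le {α β : Type*} [Fintype α] [Fintype β] {A B : Matrix α β ℝ}
    (h : ∀ i j, |A i j| ≤ B i j) : frob A ≤ frob B :=
  Real.sqrt_le_sqrt <| Finset.sum_le_sum fun i _ => Finset.sum_le_sum fun j _ =>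
    sq_le_sq.2 ((h i j).trans (le_abs_self _))

theorem frob_smul {α β : Type*} [Fintype α] [Fintype β] (c : ℝ) (A : Matrix α β ℝ) :
    frob (c • A) = |c| * frob A := by
  simp only [frob, Matrix.smul_apply, smul_eq_mul, mul_pow, ← Finset.mul_sum]
  rw [Real.sqrt_mul (sq_nonneg c), Real.sqrt_sq_eq_abs]

theorem frob_map_abs {α β : Type*} [Fintype α] [Fintype β] (A : Matrix α β ℝ) :
    frob (A.map abs) = frob A := by
  simp [frob]

theorem frob_hadamard_le {α β : Type*} [Fintype α] [Fintype β] (A B : Matrix α β ℝ) :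
    frob (A.hadamard B) ≤ frob A * frob B := by
  have hA : 0 ≤ ∑ i, ∑ j, A i j ^ 2 := by positivity
  simp only [frob]
  rw [← Real.sqrt_mul hA]
  refine Real.sqrt_le_sqrt ?_
  simp only [Matrix.hadamard_apply, mul_pow, ← Fintype.sum_prod_type']
  rw [Finset.sum_mul]
  gcongr with p
  exact Finset.single_le_sum (f := fun q : α × β => B q.1 q.2 ^ 2)
    (fun _ _ => sq_nonneg _) (Finset.mem_univ p)

theorem smallM_pos_s7 {ι : Type*} [Fintype ι] [Nonempty ι] {c : ℕ} [NeZero c]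
    (Q K : Matrix ι (Fin c) ℝ) : 0 < smallM Q K :=
  (Finset.lt_inf'_iff _).2 fun _ _ => Real.exp_pos _

theorem smallM_le_s7 {ι : Type*} [Fintype ι] [Nonempty ι] {c : ℕ} [NeZero c]
    (Q K : Matrix ι (Fin c) ℝ) (i j : ι) (l : Fin c) :
    smallM Q K ≤ Real.exp ((∑ k, Q i k * K j k) + 0.5 - (Q i l + K j l)) :=
  Finset.inf'_le (fun p : ι × ι × Fin c =>
    Real.exp ((∑ j, Q p.1 j * K p.2.1 j) + 0.5 - (Q p.1 p.2.2 + K p.2.1 p.2.2)))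
    (Finset.mem_univ (i, j, l))

theorem le_bigM_s7 {ι : Type*} [Fintype ι] [Nonempty ι] {c : ℕ} [NeZero c]
    (Q K : Matrix ι (Fin c) ℝ) (i j : ι) (l : Fin c) :
    Real.exp ((∑ k, Q i k * K j k) + 0.5 - (Q i l + K j l)) ≤ bigM Q K :=
  Finset.le_sup' (fun p : ι × ι × Fin c =>
    Real.exp ((∑ j, Q p.1 j * K p.2.1 j) + 0.5 - (Q p.1 p.2.2 + K p.2.1 p.2.2)))
    (Finset.mem_univ (i, j, l))

/-- The entries of `exp(Q) exp(K)ᵀ` are those of `exp(Q Kᵀ)` up to a factor controlled by the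
extremal values `bigM` and `smallM`. -/
theorem exists_eexp_mul_eexp_transpose_apply_eq {ι : Type*} [Fintype ι] [Nonempty ι] {c : ℕ}
    [NeZero c] (Q K : Matrix ι (Fin c) ℝ) (i j : ι) :
    ∃ r : ℝ, (eexp Q * (eexp K)ᵀ) i j = eexp (Q * Kᵀ) i j * r ∧
      (c : ℝ) / (bigM Q K * Real.exp (-0.5)) ≤ r ∧
      r ≤ (c : ℝ) / (smallM Q K * Real.exp (-0.5)) := by
  set t : Fin c → ℝ := fun l =>
    Real.exp ((∑ k, Q i k * K j k) + 0.5 - (Q i l + K j l)) with ht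
  have ht0 : ∀ l, 0 < t l := fun _ => Real.exp_pos _
  have hconst : ∀ x : ℝ, (c : ℝ) / x = ∑ _l : Fin c, 1 / x := fun x => by
    simp [div_eq_mul_inv]
  refine ⟨∑ l, 1 / (t l * Real.exp (-0.5)), ?_, ?_, ?_⟩
  · rw [Matrix.mul_apply, Finset.mul_sum]
    refine Finset.sum_congr rfl fun l _ => ?_
    simp only [eexp, Matrix.map_apply, Matrix.transpose_apply, Matrix.mul_apply, ht, one_div]
    rw [← Real.exp_add, ← Real.exp_add, ← Real.exp_neg, ← Real.exp_add]
    congr 1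
    ring
  · rw [hconst]
    refine Finset.sum_le_sum fun l _ => ?_
    have := ht0 l
    have := le_bigM_s7 Q K i j l
    gcongr
  · rw [hconst]
    refine Finset.sum_le_sum fun l _ => ?_
    have := smallM_pos_s7 Q K
    have := smallM_le_s7 Q K i j l
    gcongr

/-- if |c₁/(𝓜e) − 1| ≥ |c₁/(𝔐e) − 1| (with e = exp(−0.5)), then
‖exp(Q̄)exp(K̄)ᵀ − exp(Q̄K̄ᵀ) ⊙ exp(Q̃K̃ᵀ)‖_F ≤
  (c₁/(𝓜e)) ‖exp(Q̄K̄ᵀ)‖_F ‖U_m − exp(Q̃K̃ᵀ)‖_F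
  + |c₁/(𝓜e) − 1| ‖exp(Q̄K̄ᵀ)‖_F ‖exp(Q̃K̃ᵀ)‖_F. -/
theorem stmt_7 (m c₁ c₂ : ℕ) [NeZero m] [NeZero c₁] [NeZero c₂]
    (Qb Kb : Matrix (Fin m) (Fin c₁) ℝ) (Qt Kt : Matrix (Fin m) (Fin c₂) ℝ)
    (h : |(c₁ : ℝ) / (smallM Qb Kb * Real.exp (-0.5)) - 1| ≥
        |(c₁ : ℝ) / (bigM Qb Kb * Real.exp (-0.5)) - 1|) :
    frob (eexp Qb * (eexp Kb)ᵀ - (eexp (Qb * Kbᵀ)).hadamard (eexp (Qt * Ktᵀ))) ≤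
      (c₁ : ℝ) / (smallM Qb Kb * Real.exp (-0.5)) * frob (eexp (Qb * Kbᵀ)) *
          frob (allOnes (Fin m) - eexp (Qt * Ktᵀ)) +
        |(c₁ : ℝ) / (smallM Qb Kb * Real.exp (-0.5)) - 1| * frob (eexp (Qb * Kbᵀ)) *
          frob (eexp (Qt * Ktᵀ)) := by
  have hs : 0 ≤ (c₁ : ℝ) / (smallM Qb Kb * Real.exp (-0.5)) := by
    have := smallM_pos_s7 Qb Kb
    positivity
  have factor := exists_eexp_mul_eexp_transpose_apply_eq Qb Kb
  set s : ℝ := (c₁ : ℝ) / (smallM Qb Kb * Real.exp (-0.5))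
  set E := eexp (Qb * Kbᵀ) with hE
  set W := eexp (Qt * Ktᵀ) with hW
  have hE0 : ∀ i j, 0 < E i j := fun _ _ => Real.exp_pos _
  have hW0 : ∀ i j, 0 < W i j := fun _ _ => Real.exp_pos _
  set D := (allOnes (Fin m) - W).map abs with hD
  calc _ ≤ frob (s • E.hadamard D + |s - 1| • E.hadamard W) := by
        refine frob_le_frob_of_abs_le fun i j => ?_
        obtain ⟨r, hr, hbr, hrs⟩ := factor i j
        have hr0 : |r| ≤ s := by
          refine abs_le.2 ⟨?_, hrs⟩
          have : 0 < bigM Qb Kb := (Real.exp_pos _).trans_le (le_bigM_s7 Qb Kb i j 0)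
          have : 0 ≤ (c₁ : ℝ) / (bigM Qb Kb * Real.exp (-0.5)) := by positivity
          linarith
        have hr1 : |r - 1| ≤ |s - 1| :=
          (abs_le_max_abs_abs (sub_le_sub_right hbr 1) (sub_le_sub_right hrs 1)).trans
            (max_le h le_rfl)
        simp only [Matrix.sub_apply, Matrix.add_apply, Matrix.smul_apply, Matrix.hadamard_apply,
          hr, smul_eq_mul, hD, Matrix.map_apply, allOnes, Matrix.of_apply]
        have hEij := hE0 i j
        have hWij := hW0 i j
        calc |E i j * r - E i j * W i j|
            = |E i j * (r * (1 - W i j) + (r - 1) * W i j)| := by congr 1; ring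
          _ = E i j * |r * (1 - W i j) + (r - 1) * W i j| := by rw [abs_mul, abs_of_pos hEij]
          _ ≤ E i j * (|r| * |1 - W i j| + |r - 1| * W i j) := by
              gcongr
              refine (abs_add_le _ _).trans_eq ?_
              rw [abs_mul, abs_mul, abs_of_pos hWij]
          _ ≤ E i j * (s * |1 - W i j| + |s - 1| * W i j) := by gcongr
          _ = _ := by ring
    _ ≤ s * frob (E.hadamard D) + |s - 1| * frob (E.hadamard W) := by
        refine (frob_add_le _ _).trans_eq ?_
        rw [frob_smul, frob_smul, abs_of_nonneg hs, abs_abs]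
    _ ≤ s * (frob E * frob D) + |s - 1| * (frob E * frob W) := by
        gcongr <;> exact frob_hadamard_le _ _
    _ = _ := by rw [hD, frob_map_abs]; ring
end
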